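/- Let M be the exponent matrix of the loop polynomial with exponents a_1, …, a_N, and suppose N is even. Define r^{even} ∈ ℤ^N by r^{even}_i = a_i − 1 if i is even and r^{even}_i = 0 if i is odd, and define r^{odd} ∈ ℤ^N by r^{odd}_i = a_i − 1 if i is odd and r^{odd}_i = 0 if i is even. Then both M⁻¹(r^{even} + 𝟙) and M⁻¹(r^{odd} + 𝟙) have all entries in ℤ (where 𝟙 = (1, …, 1)ᵀ). -/

import Mathlib

/-- The exponent matrix (over `ℚ`) of the loop polynomial with exponents `a`:
`M i i = a i`, `M i (i+1) = 1` (indices mod `N`), all other entries `0`. -/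
def loopMatrixQ (N : ℕ) [NeZero N] (a : Fin N → ℤ) : Matrix (Fin N) (Fin N) ℚ :=
  Matrix.of fun i j => if j = i then (a i : ℚ) else if j = i + 1 then 1 else 0

theorem Fin.add_one_ne_self_of_two_le {N : ℕ} [NeZero N] (hN : 2 ≤ N) (i : Fin N) :
    i + 1 ≠ i := by
  obtain ⟨n, rfl⟩ : ∃ n, N = n + 2 := ⟨N - 2, by omega⟩
  simp

theorem Fin.even_val_add_one_iff {N : ℕ} [NeZero N] (hN : 2 ≤ N) (hNeven : Even N) (i : Fin N) :
    Even ((i + 1 : Fin N) : ℕ) ↔ ¬ Even (i : ℕ) := by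
  have h1 : ((1 : Fin N) : ℕ) = 1 := by
    rw [Fin.val_one', Nat.mod_eq_of_lt (by omega)]
  rw [Fin.val_add, h1, Nat.even_iff, Nat.mod_mod_of_dvd _ hNeven.two_dvd, ← Nat.even_iff,
    Nat.even_add_one]

theorem loopMatrixQ_mulVec_apply {N : ℕ} [NeZero N] (hN : 2 ≤ N) (a : Fin N → ℤ)
    (v : Fin N → ℚ) (i : Fin N) :
    (loopMatrixQ N a).mulVec v i = a i * v i + v (i + 1) := by
  have hi := Fin.add_one_ne_self_of_two_le hN i
  have hrow : ∀ j, loopMatrixQ N a i j * v j =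
      (if j = i then (a i : ℚ) * v j else 0) + (if j = i + 1 then v j else 0) := by
    intro j
    by_cases hj : j = i
    · subst hj
      simp [loopMatrixQ, hi.symm]
    · simp [loopMatrixQ, hj]
  simp only [Matrix.mulVec, dotProduct, hrow, Finset.sum_add_distrib]
  simp

theorem loopMatrixQ_det_ne_zero {N : ℕ} [NeZero N] (hN : 2 ≤ N) (a : Fin N → ℤ)
    (ha : ∀ i, 2 ≤ a i) : (loopMatrixQ N a).det ≠ 0 := by
  intro hdet
  obtain ⟨v, hv, hMv⟩ := Matrix.exists_mulVec_eq_zero_iff.mpr hdet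
  obtain ⟨i, -, hmax⟩ := Finset.exists_max_image Finset.univ (fun j => |v j|)
    Finset.univ_nonempty
  have hrow : (a i : ℚ) * v i + v (i + 1) = 0 := by
    rw [← loopMatrixQ_mulVec_apply hN, hMv, Pi.zero_apply]
  have hai : (2 : ℚ) ≤ a i := by exact_mod_cast ha i
  have habs : (a i : ℚ) * |v i| = |v (i + 1)| := by
    rw [← abs_neg (v (i + 1)), ← eq_neg_of_add_eq_zero_left hrow, abs_mul,
      abs_of_nonneg (by linarith : (0 : ℚ) ≤ a i)]
  have hle := hmax (i + 1) (Finset.mem_univ _)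
  have hzero : |v i| ≤ 0 := by nlinarith [abs_nonneg (v i)]
  exact hv (funext fun j => abs_nonpos_iff.mp ((hmax j (Finset.mem_univ _)).trans hzero))

/-- If `w = M v` for the loop matrix `M` and an integer vector `v`, then `M⁻¹ w` is integral. -/
theorem exists_int_loopMatrixQ_inv_mulVec {N : ℕ} [NeZero N] (hN : 2 ≤ N) (a : Fin N → ℤ)
    (ha : ∀ i, 2 ≤ a i) (v : Fin N → ℤ) (w : Fin N → ℚ)
    (hw : ∀ i, w i = a i * v i + v (i + 1)) (i : Fin N) :
    ∃ z : ℤ, ((loopMatrixQ N a)⁻¹.mulVec w) i = z := by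
  have hMv : w = (loopMatrixQ N a).mulVec (fun j => (v j : ℚ)) :=
    funext fun j => by rw [loopMatrixQ_mulVec_apply hN, hw]
  refine ⟨v i, ?_⟩
  rw [hMv, Matrix.mulVec_mulVec,
    Matrix.nonsing_inv_mul _ (loopMatrixQ_det_ne_zero hN a ha).isUnit, Matrix.one_mulVec]

/-- For an even-variable loop, both `M⁻¹ (r^even + 𝟙)` and `M⁻¹ (r^odd + 𝟙)` are
integer vectors, where `r^even i = a i - 1` on (one-based) even indices and `0`
elsewhere, and `r^odd i = a i - 1` on (one-based) odd indices and `0` elsewhere.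
(Indices here are zero-based, so the one-based index `i+1` is odd exactly when
`(i : ℕ)` is even.) -/
theorem loop_even_identity_representations (N : ℕ) [NeZero N] (hN : 2 ≤ N)
    (hNeven : Even N) (a : Fin N → ℤ) (ha : ∀ i, 2 ≤ a i) :
    (∀ i : Fin N, ∃ z : ℤ,
      ((loopMatrixQ N a)⁻¹.mulVec
        (fun j => (if Even (j : ℕ) then 0 else (a j : ℚ) - 1) + 1)) i = z) ∧
    (∀ i : Fin N, ∃ z : ℤ,
      ((loopMatrixQ N a)⁻¹.mulVec
        (fun j => (if Even (j : ℕ) then (a j : ℚ) - 1 else 0) + 1)) i = z) := by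
  refine ⟨exists_int_loopMatrixQ_inv_mulVec hN a ha (fun j => if Even (j : ℕ) then 0 else 1) _ ?_,
    exists_int_loopMatrixQ_inv_mulVec hN a ha (fun j => if Even (j : ℕ) then 1 else 0) _ ?_⟩
  all_goals
    intro i
    by_cases hi : Even (i : ℕ) <;> simp [Fin.even_val_add_one_iff hN hNeven, hi]
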